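/- For every pair of bits q₁, q₅ ∈ {0,1}, every middle string A = (0, A₁, A₀) with A₁, A₀ ∈ {0,1}, every sign s ∈ {+1,−1}, and all bits i,j,k ∈ {0,1} with i+j+k odd, the 5-qubit vector v_{A,y,s} satisfies (I ⊗ P_i ⊗ P_j ⊗ P_k ⊗ Y) v_{A,y,s} = s · (√−1)^{i+j+k+1} · (−1)^{q₅ + j A₁ + k A₀} · v_{A,y,s}. (This single formula reproduces the paper's four listed cases: eigenvalue ±(−1)^{q₅}α for A=000, ±(−1)^{q₅+k}α for A=001, ±(−1)^{q₅+j}α for A=010, and ∓(−1)^{q₅+i}α for A=011, where α=(√−1)^{i+j+k+1}, using that i+j+k is odd.) -/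

import Mathlib

open Matrix Complex

noncomputable section

/-- Single-qubit Pauli X. -/
def Xg : Matrix (Fin 2) (Fin 2) ℂ := !![0, 1; 1, 0]
/-- Single-qubit Pauli Y. -/
def Yg : Matrix (Fin 2) (Fin 2) ℂ := !![0, -Complex.I; Complex.I, 0]
/-- Single-qubit Pauli Z. -/
def Zg : Matrix (Fin 2) (Fin 2) ℂ := !![1, 0; 0, -1]
/-- P₀ = X, P₁ = Y. -/
def Pg : Fin 2 → Matrix (Fin 2) (Fin 2) ℂ := fun i => if i = 0 then Xg else Yg

/-- Tensor (Kronecker) product of `n` single-qubit operators, as a matrix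
indexed by bit strings. -/
def tens {n : ℕ} (M : Fin n → Matrix (Fin 2) (Fin 2) ℂ) :
    Matrix (Fin n → Fin 2) (Fin n → Fin 2) ℂ :=
  Matrix.of fun r c => ∏ m, M m (r m) (c m)

/-- Computational basis vector |q⟩. -/
def ket {n : ℕ} (q : Fin n → Fin 2) : (Fin n → Fin 2) → ℂ :=
  fun r => if r = q then 1 else 0

/-- The eigenvector v_{A,y,s} of the paper (5 qubits), with A = (0, A₁, A₀). -/
def vAy (q₁ q₅ A₁ A₀ : Fin 2) (s : ℂ) : (Fin 5 → Fin 2) → ℂ :=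
  (- ket ![q₁, 0, A₁, A₀, q₅] + ket ![q₁+1, 0, A₁, A₀, q₅]
    + ket ![q₁, 0, A₁, A₀, q₅+1] + ket ![q₁+1, 0, A₁, A₀, q₅+1])
  + s • (ket ![q₁+1, 1, A₁+1, A₀+1, q₅+1] - ket ![q₁, 1, A₁+1, A₀+1, q₅]
    - ket ![q₁+1, 1, A₁+1, A₀+1, q₅] - ket ![q₁, 1, A₁+1, A₀+1, q₅+1])

theorem tens_mulVec_ket {n : ℕ} {M : Fin n → Matrix (Fin 2) (Fin 2) ℂ}
    {p q : Fin n → Fin 2} {c : Fin n → ℂ}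
    (h : ∀ m x, M m x (q m) = c m * if x = p m then 1 else 0) :
    (tens M).mulVec (ket q) = (∏ m, c m) • ket p := by
  funext r
  have hcol : (tens M).mulVec (ket q) r = ∏ m, M m (r m) (q m) := by
    simp [tens, ket, Matrix.mulVec, dotProduct]
  rw [hcol]
  simp only [h, Finset.prod_mul_distrib, Pi.smul_apply, smul_eq_mul, ket, funext_iff,
    Finset.prod_ite_zero, Finset.prod_const_one, Finset.mem_univ, true_imp_iff]

theorem Pg_apply (i x b : Fin 2) :
    Pg i x b = (I ^ (i : ℕ) * (-1) ^ ((i : ℕ) * (b : ℕ))) * if x = b + 1 then 1 else 0 := by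
  fin_cases i <;> fin_cases x <;> fin_cases b <;> simp [Pg, Xg, Yg]

theorem pauli_mulVec_ket (i j k a b c d e : Fin 2) :
    (tens ![1, Pg i, Pg j, Pg k, Yg]).mulVec (ket ![a, b, c, d, e]) =
      (I ^ ((i : ℕ) + (j : ℕ) + (k : ℕ) + 1) *
        ((-1) ^ ((i : ℕ) * (b : ℕ)) * (-1) ^ ((j : ℕ) * (c : ℕ)) *
          (-1) ^ ((k : ℕ) * (d : ℕ)) * (-1) ^ (e : ℕ))) •
        ket ![a, b + 1, c + 1, d + 1, e + 1] := by
  have hY : Yg = Pg 1 := by simp [Pg]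
  rw [tens_mulVec_ket (p := ![a, b + 1, c + 1, d + 1, e + 1])
    (c := ![1, I ^ (i : ℕ) * (-1) ^ ((i : ℕ) * (b : ℕ)),
      I ^ (j : ℕ) * (-1) ^ ((j : ℕ) * (c : ℕ)), I ^ (k : ℕ) * (-1) ^ ((k : ℕ) * (d : ℕ)),
      I * (-1) ^ (e : ℕ)])]
  · congr 1
    simp only [Fin.prod_univ_five, Matrix.cons_val]
    ring
  · intro m x
    fin_cases m
    · change (1 : Matrix (Fin 2) (Fin 2) ℂ) x a = 1 * if x = a then 1 else 0
      rw [Matrix.one_apply, one_mul]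
    · exact Pg_apply i x b
    · exact Pg_apply j x c
    · exact Pg_apply k x d
    · change Yg x e = (I * (-1) ^ (e : ℕ)) * if x = e + 1 then 1 else 0
      rw [hY, Pg_apply, Fin.val_one, pow_one, one_mul]

theorem neg_one_pow_mul_add_one (i b : Fin 2) :
    (-1 : ℂ) ^ ((i : ℕ) * ((b + 1 : Fin 2) : ℕ)) =
      (-1) ^ (i : ℕ) * (-1) ^ ((i : ℕ) * (b : ℕ)) := by
  fin_cases i <;> fin_cases b <;> simp

theorem neg_one_pow_add_one (b : Fin 2) :
    (-1 : ℂ) ^ ((b + 1 : Fin 2) : ℕ) = -(-1) ^ (b : ℕ) := by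
  fin_cases b <;> simp

theorem stmt14 (q₁ q₅ A₁ A₀ : Fin 2) (s : ℂ) (hs : s = 1 ∨ s = -1)
    (i j k : Fin 2) (hodd : Odd ((i : ℕ) + (j : ℕ) + (k : ℕ))) :
    (tens ![1, Pg i, Pg j, Pg k, Yg]).mulVec (vAy q₁ q₅ A₁ A₀ s) =
      (s * Complex.I ^ ((i : ℕ) + (j : ℕ) + (k : ℕ) + 1) *
        (-1 : ℂ) ^ ((q₅ : ℕ) + (j : ℕ) * (A₁ : ℕ) + (k : ℕ) * (A₀ : ℕ))) •
        vAy q₁ q₅ A₁ A₀ s := by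
  have hs2 : s * s = 1 := by rcases hs with rfl | rfl <;> norm_num
  have hsign : (-1 : ℂ) ^ (i : ℕ) * (-1) ^ (j : ℕ) * (-1) ^ (k : ℕ) = -1 := by
    rw [← pow_add, ← pow_add, hodd.neg_one_pow]
  have hadd (b : Fin 2) : b + 1 + 1 = b := by fin_cases b <;> rfl
  have h11 : (1 + 1 : Fin 2) = 0 := rfl
  simp only [vAy, Matrix.mulVec_add, Matrix.mulVec_sub, Matrix.mulVec_neg, Matrix.mulVec_smul,
    pauli_mulVec_ket, neg_one_pow_mul_add_one, neg_one_pow_add_one, hadd, h11, zero_add,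
    Fin.val_zero, Fin.val_one, mul_zero, mul_one, pow_zero, one_mul, pow_add _ (q₅ : ℕ),
    pow_add _ ((q₅ : ℕ) + _)]
  generalize I ^ ((i : ℕ) + (j : ℕ) + (k : ℕ) + 1) = w
  generalize (-1 : ℂ) ^ ((j : ℕ) * (A₁ : ℕ)) = u at *
  generalize (-1 : ℂ) ^ ((k : ℕ) * (A₀ : ℕ)) = v at *
  generalize (-1 : ℂ) ^ (q₅ : ℕ) = z at *
  have hflip : (-1 : ℂ) ^ (i : ℕ) * ((-1) ^ (j : ℕ) * u) * ((-1) ^ (k : ℕ) * v) = -(u * v) := by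
    linear_combination u * v * hsign
  have hssmul (x : (Fin 5 → Fin 2) → ℂ) : s • s • x = x := by rw [smul_smul, hs2, one_smul]
  have hscal : s * w * (z * u * v) = (w * (u * v * z)) * s := by ring
  simp only [hflip, hscal, mul_smul _ s, smul_add s, hssmul]
  module
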